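/- For every ε > 0 there exists n₀ such that for every n ≥ n₀, every 3-uniform hypergraph H on n vertices with minimum codegree δ₂(H) ≥ (1/3 + ε)n contains a homomorphic copy of the tight cycle C₁₁. -/

import Mathlib

open Finset

/-- A 3-uniform hypergraph given by its edge set: every edge has exactly 3 vertices. -/
def IsUniform3 {V : Type*} (H : Finset (Finset V)) : Prop :=
  ∀ e ∈ H, e.card = 3

/-- The codegree of a pair of vertices: the number of vertices `w` with `{u,v,w} ∈ H`. -/
noncomputable def codeg {V : Type*} [DecidableEq V] (H : Finset (Finset V)) (u v : V) : ℕ :=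
  {w : V | ({u, v, w} : Finset V) ∈ H}.ncard

/-- The minimum codegree `δ₂(H)`: the minimum of `codeg H u v` over pairs of distinct vertices. -/
noncomputable def minCodeg {V : Type*} [DecidableEq V] (H : Finset (Finset V)) : ℕ :=
  sInf {d : ℕ | ∃ u v : V, u ≠ v ∧ codeg H u v = d}

/-- `H` contains a homomorphic copy of the tight cycle `C_ℓ`: a cyclic sequence of vertices
(indexed by `ZMod ℓ`, not necessarily distinct) in which every three cyclically consecutive
vertices are pairwise distinct and form an edge of `H`. -/
def HasHomTightCycle {V : Type*} [DecidableEq V] (ℓ : ℕ) (H : Finset (Finset V)) : Prop :=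
  ∃ x : ZMod ℓ → V, ∀ i : ZMod ℓ,
    x (i - 1) ≠ x i ∧ x i ≠ x (i + 1) ∧ x (i - 1) ≠ x (i + 1) ∧
      ({x (i - 1), x i, x (i + 1)} : Finset V) ∈ H

/-- `H` contains a (genuine) copy of the tight cycle `C_ℓ`: `ℓ` distinct vertices, cyclically
ordered, such that every three cyclically consecutive vertices form an edge of `H`. -/
def HasTightCycle {V : Type*} [DecidableEq V] (ℓ : ℕ) (H : Finset (Finset V)) : Prop :=
  ∃ x : ZMod ℓ → V, Function.Injective x ∧
    ∀ i : ZMod ℓ, ({x (i - 1), x i, x (i + 1)} : Finset V) ∈ H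

/-- The arc `u → v` of the apex digraph `D`: some `K₄⁻` of `H` contains `u` and `v`
with apex `v`; i.e. there are two further vertices `a, b` (with `u,v,a,b` distinct)
such that the three edges through `v` on `{u,v,a,b}` all lie in `H`. -/
def ArcD {V : Type*} [DecidableEq V] (H : Finset (Finset V)) (u v : V) : Prop :=
  ∃ a b : V, ({u, v, a, b} : Finset V).card = 4 ∧
    ({v, u, a} : Finset V) ∈ H ∧ ({v, u, b} : Finset V) ∈ H ∧ ({v, a, b} : Finset V) ∈ H

/-- `{u,v}` is a base pair: some `K₄⁻` of `H` contains `u` and `v` with neither `u` nor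
`v` being the apex; i.e. there are further vertices `w, a` (with `u,v,w,a` distinct) with
apex `w`, so that the three edges through `w` on `{u,v,w,a}` all lie in `H`. -/
def BasePair {V : Type*} [DecidableEq V] (H : Finset (Finset V)) (u v : V) : Prop :=
  ∃ w a : V, ({u, v, w, a} : Finset V).card = 4 ∧
    ({w, u, v} : Finset V) ∈ H ∧ ({w, u, a} : Finset V) ∈ H ∧ ({w, v, a} : Finset V) ∈ H

/-- The degree of `v` in the base-pair graph `B`. -/
noncomputable def degB {V : Type*} [DecidableEq V] (H : Finset (Finset V)) (v : V) : ℕ :=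
  {u : V | BasePair H u v}.ncard

/-- The out-degree of `v` in the apex digraph `D`. -/
noncomputable def outDegD {V : Type*} [DecidableEq V] (H : Finset (Finset V)) (v : V) : ℕ :=
  {u : V | ArcD H v u}.ncard

/-- The in-degree of `v` in the apex digraph `D`. -/
noncomputable def inDegD {V : Type*} [DecidableEq V] (H : Finset (Finset V)) (v : V) : ℕ :=
  {u : V | ArcD H u v}.ncard

/-- The codegree Turán number `ex₂(n, C_ℓ)`: the maximum of `δ₂(H)` over all 3-uniform
hypergraphs `H` on `n` vertices containing no copy of the tight cycle `C_ℓ`. -/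
noncomputable def exCodeg (ℓ n : ℕ) : ℕ :=
  sSup {k : ℕ | ∃ H : Finset (Finset (Fin n)),
    IsUniform3 H ∧ ¬ HasTightCycle ℓ H ∧ minCodeg H = k}

/-- Among three subsets of `V` each of size more than `|V| / 3`, two intersect. -/
theorem exists_mem_inter_of_card_lt {V : Type*} [Fintype V] {A B C : Set V}
    (hA : Fintype.card V < 3 * A.ncard) (hB : Fintype.card V < 3 * B.ncard) (hC : Fintype.card V < 3 * C.ncard) :
    (A ∩ B).Nonempty ∨ (A ∩ C).Nonempty ∨ (B ∩ C).Nonempty := by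
  by_contra! h
  obtain ⟨hAB, hAC, hBC⟩ := h
  rw [← Set.disjoint_iff_inter_eq_empty] at hAB hAC hBC
  have h₁ := Set.ncard_union_eq hAB A.toFinite B.toFinite
  have h₂ := Set.ncard_union_eq (hAC.union_left hBC) (A ∪ B).toFinite C.toFinite
  have h₃ := Set.ncard_le_card (A ∪ B ∪ C)
  rw [Nat.card_eq_fintype_card] at h₃
  omega

section ApexStructure

variable {V : Type*} [DecidableEq V] {H : Finset (Finset V)}

/-- The edge `{a, b, c}` lies in a `K₄⁻` of `H` with apex `a`. -/
def IsApex (H : Finset (Finset V)) (a b c : V) : Prop :=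
  ({a, b, c} : Finset V) ∈ H ∧
    ∃ d, ({a, b, d} : Finset V) ∈ H ∧ ({a, c, d} : Finset V) ∈ H

/-- The pair `a, b` lies in an edge with apex `a`. -/
def IsOut (H : Finset (Finset V)) (a b : V) : Prop := ∃ c, IsApex H a b c

/-- The pair `b, c` lies in an edge whose apex is the third vertex. -/
def IsBase (H : Finset (Finset V)) (b c : V) : Prop := ∃ a, IsApex H a b c

theorem edge_swap_left {a b c : V} (h : ({a, b, c} : Finset V) ∈ H) :
    ({b, a, c} : Finset V) ∈ H := by
  rwa [Finset.insert_comm]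

theorem edge_swap_right {a b c : V} (h : ({a, b, c} : Finset V) ∈ H) :
    ({a, c, b} : Finset V) ∈ H := by
  rwa [Finset.pair_comm]

theorem edge_ne (hH : IsUniform3 H) {a b c : V} (h : ({a, b, c} : Finset V) ∈ H) :
    a ≠ b ∧ b ≠ c ∧ a ≠ c := by
  by_contra hne
  have : ({a, b, c} : Finset V).card ≤ 2 := by
    by_cases hab : a = b
    · subst hab; simpa using Finset.card_le_two
    by_cases hbc : b = c
    · subst hbc; simpa using Finset.card_le_two
    have hac : a = c := by tauto
    subst hac
    rw [Finset.insert_comm]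
    simpa using Finset.card_le_two
  have := hH _ h
  omega

theorem IsApex.symm {a b c : V} (h : IsApex H a b c) : IsApex H a c b :=
  ⟨edge_swap_right h.1, h.2.imp fun _ hd => hd.symm⟩

theorem IsBase.symm {b c : V} (h : IsBase H b c) : IsBase H c b :=
  h.imp fun _ ha => ha.symm

theorem hasHomTightCycle_eleven (hH : IsUniform3 H) (x₀ x₁ x₂ x₃ x₄ x₅ x₆ x₇ x₈ x₉ x₁₀ : V)
    (h₀ : ({x₁₀, x₀, x₁} : Finset V) ∈ H) (h₁ : ({x₀, x₁, x₂} : Finset V) ∈ H)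
    (h₂ : ({x₁, x₂, x₃} : Finset V) ∈ H) (h₃ : ({x₂, x₃, x₄} : Finset V) ∈ H)
    (h₄ : ({x₃, x₄, x₅} : Finset V) ∈ H) (h₅ : ({x₄, x₅, x₆} : Finset V) ∈ H)
    (h₆ : ({x₅, x₆, x₇} : Finset V) ∈ H) (h₇ : ({x₆, x₇, x₈} : Finset V) ∈ H)
    (h₈ : ({x₇, x₈, x₉} : Finset V) ∈ H) (h₉ : ({x₈, x₉, x₁₀} : Finset V) ∈ H)
    (h₁₀ : ({x₉, x₁₀, x₀} : Finset V) ∈ H) :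
    HasHomTightCycle 11 H := by
  let x : Fin 11 → V := ![x₀, x₁, x₂, x₃, x₄, x₅, x₆, x₇, x₈, x₉, x₁₀]
  have hx : ∀ i, ({x (i - 1), x i, x (i + 1)} : Finset V) ∈ H := by
    intro i
    fin_cases i
    exacts [h₀, h₁, h₂, h₃, h₄, h₅, h₆, h₇, h₈, h₉, h₁₀]
  refine ⟨x, fun i => ?_⟩
  obtain ⟨hab, hbc, hac⟩ := edge_ne hH (hx i)
  exact ⟨hab, hbc, hac, hx i⟩

theorem not_isOut_of_isOut (hH : IsUniform3 H) (hC : ¬ HasHomTightCycle 11 H) {a b : V}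
    (hab : IsOut H a b) : ¬ IsOut H b a := by
  rintro ⟨f, h₁, e, h₂, h₃⟩
  obtain ⟨c, h₄, d, h₅, h₆⟩ := hab
  apply hC
  apply hasHomTightCycle_eleven hH b a d c a b e f b a f <;>
    grind only [edge_swap_left, edge_swap_right]

theorem not_isBase_of_isOut (hH : IsUniform3 H) (hC : ¬ HasHomTightCycle 11 H) {a b : V}
    (hab : IsOut H a b) : ¬ IsBase H a b := by
  rintro ⟨c, h₁, e, h₂, h₃⟩
  obtain ⟨f, h₄, g, h₅, h₆⟩ := hab
  apply hC
  apply hasHomTightCycle_eleven hH a c e b c a b f a g b <;>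
    grind only [edge_swap_left, edge_swap_right]

theorem IsOut.ne (hH : IsUniform3 H) {a b : V} (hab : IsOut H a b) : a ≠ b :=
  have ⟨_, h⟩ := hab
  (edge_ne hH h.1).1

theorem IsBase.ne (hH : IsUniform3 H) {a b : V} (hab : IsBase H a b) : a ≠ b :=
  have ⟨_, h⟩ := hab
  (edge_ne hH h.1).2.1

variable [Fintype V]

theorem exists_isApex (hH : IsUniform3 H)
    (hd : ∀ u v : V, u ≠ v → Fintype.card V < 3 * codeg H u v) {a b c : V}
    (h : ({a, b, c} : Finset V) ∈ H) : IsApex H a b c ∨ IsApex H b a c ∨ IsApex H c a b := by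
  obtain ⟨hab, hbc, hac⟩ := edge_ne hH h
  obtain ⟨d, h₁, h₂⟩ | ⟨d, h₁, h₂⟩ | ⟨d, h₁, h₂⟩ :=
    exists_mem_inter_of_card_lt (hd a b hab) (hd a c hac) (hd b c hbc)
  · exact Or.inl ⟨h, d, h₁, h₂⟩
  · exact Or.inr (Or.inl ⟨edge_swap_left h, d, edge_swap_left h₁, h₂⟩)
  · exact Or.inr (Or.inr ⟨edge_swap_left (edge_swap_right h), d,
      edge_swap_left h₁, edge_swap_left h₂⟩)

theorem IsOut.isApex (hH : IsUniform3 H) (hC : ¬ HasHomTightCycle 11 H)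
    (hd : ∀ u v : V, u ≠ v → Fintype.card V < 3 * codeg H u v) {a b c : V}
    (hab : IsOut H a b) (h : ({a, b, c} : Finset V) ∈ H) : IsApex H a b c := by
  obtain h | h | h := exists_isApex hH hd h
  · exact h
  · exact absurd ⟨c, h⟩ (not_isOut_of_isOut hH hC hab)
  · exact absurd ⟨c, h⟩ (not_isBase_of_isOut hH hC hab)

theorem IsBase.isApex (hH : IsUniform3 H) (hC : ¬ HasHomTightCycle 11 H)
    (hd : ∀ u v : V, u ≠ v → Fintype.card V < 3 * codeg H u v) {a b c : V}
    (hab : IsBase H a b) (h : ({a, b, c} : Finset V) ∈ H) : IsApex H c a b := by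
  obtain h | h | h := exists_isApex hH hd h
  · exact absurd hab (not_isBase_of_isOut hH hC ⟨c, h⟩)
  · exact absurd hab.symm (not_isBase_of_isOut hH hC ⟨c, h⟩)
  · exact h

theorem exists_edge (hd : ∀ u v : V, u ≠ v → Fintype.card V < 3 * codeg H u v) {u v : V}
    (huv : u ≠ v) : ∃ w, ({u, v, w} : Finset V) ∈ H :=
  Set.nonempty_of_ncard_ne_zero (s := {w | ({u, v, w} : Finset V) ∈ H}) <| by
    have := hd u v huv
    rw [codeg] at this
    omega

/-- No vertex is both the tail and the head of an arc. -/
theorem not_isOut_of_isOut_right (hH : IsUniform3 H) (hC : ¬ HasHomTightCycle 11 H)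
    (hd : ∀ u v : V, u ≠ v → Fintype.card V < 3 * codeg H u v) {u v w : V}
    (huv : IsOut H u v) : ¬ IsOut H v w := by
  intro hvw
  have hO : Fintype.card V < 3 * {x | IsOut H v x}.ncard := by
    refine (hd v w (hvw.ne hH)).trans_le (Nat.mul_le_mul_left 3 (Set.ncard_le_ncard ?_))
    exact fun x hx => ⟨w, (hvw.isApex hH hC hd hx).symm⟩
  have hB : Fintype.card V < 3 * {x | IsBase H v x}.ncard := by
    refine (hd u v (huv.ne hH)).trans_le (Nat.mul_le_mul_left 3 (Set.ncard_le_ncard ?_))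
    exact fun x hx => ⟨u, huv.isApex hH hC hd hx⟩
  obtain ⟨c, hc⟩ := huv
  have hvc : IsBase H v c := ⟨u, hc⟩
  have hI : Fintype.card V < 3 * {x | IsOut H x v}.ncard := by
    refine (hd v c (hvc.ne hH)).trans_le (Nat.mul_le_mul_left 3 (Set.ncard_le_ncard ?_))
    exact fun x hx => ⟨c, hvc.isApex hH hC hd hx⟩
  obtain ⟨x, h₁, h₂⟩ | ⟨x, h₁, h₂⟩ | ⟨x, h₁, h₂⟩ := exists_mem_inter_of_card_lt hO hB hI
  · exact not_isBase_of_isOut hH hC h₁ h₂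
  · exact not_isOut_of_isOut hH hC h₁ h₂
  · exact not_isBase_of_isOut hH hC h₂ h₁.symm

/-- A 3-uniform hypergraph on at least three vertices in which every codegree exceeds a third
of the number of vertices contains a homomorphic copy of `C₁₁`. -/
theorem hasHomTightCycle_eleven_of_card_lt_codeg (hH : IsUniform3 H)
    (hV : 3 ≤ Fintype.card V)
    (hd : ∀ u v : V, u ≠ v → Fintype.card V < 3 * codeg H u v) : HasHomTightCycle 11 H := by
  by_contra hC
  obtain ⟨u, v, huv⟩ := Fintype.exists_pair_of_one_lt_card (by omega : 1 < Fintype.card V)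
  obtain ⟨w, hw⟩ := exists_edge hd huv
  obtain ⟨a, b, c, habc⟩ : ∃ a b c, IsApex H a b c := by
    obtain h | h | h := exists_isApex hH hd hw <;> exact ⟨_, _, _, h⟩
  have hbc : IsBase H b c := ⟨a, habc⟩
  have hcard : 1 < {x | ({b, c, x} : Finset V) ∈ H}.ncard := by
    have := hd b c (hbc.ne hH)
    rw [codeg] at this
    omega
  obtain ⟨a', ha', hne⟩ := Set.exists_ne_of_one_lt_ncard hcard a
  have ha'bc := hbc.isApex hH hC hd ha'
  obtain ⟨x, hx⟩ := exists_edge hd hne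
  obtain h | h | h := exists_isApex hH hd hx
  · exact not_isOut_of_isOut_right hH hC hd ⟨x, h⟩ ⟨c, habc⟩
  · exact not_isOut_of_isOut_right hH hC hd ⟨x, h⟩ ⟨c, ha'bc⟩
  · exact not_isOut_of_isOut_right hH hC hd ⟨a', h.symm⟩ ⟨c, habc⟩

end ApexStructure

/-- For every `ε > 0` there exists `n₀` such that for every `n ≥ n₀`, every 3-uniform
hypergraph on `n` vertices with minimum codegree at least `(1/3 + ε)n` contains a
homomorphic copy of the tight cycle `C₁₁`. -/
theorem codegree_hom_C11 :
    ∀ ε : ℝ, 0 < ε → ∃ n₀ : ℕ, ∀ n : ℕ, n₀ ≤ n →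
      ∀ H : Finset (Finset (Fin n)), IsUniform3 H →
        ((1 / 3 : ℝ) + ε) * n ≤ (minCodeg H : ℝ) →
          HasHomTightCycle 11 H := by
  refine fun ε hε => ⟨3, fun n hn H hH hmin => ?_⟩
  refine hasHomTightCycle_eleven_of_card_lt_codeg hH (by simpa using hn) fun u v huv => ?_
  have hle : minCodeg H ≤ codeg H u v := Nat.sInf_le ⟨u, v, huv, rfl⟩
  have hle' : (minCodeg H : ℝ) ≤ codeg H u v := by exact_mod_cast hle
  have hn' : (0 : ℝ) < n := by exact_mod_cast (by omega : 0 < n)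
  have := mul_pos hε hn'
  rw [Fintype.card_fin]
  have : (n : ℝ) < 3 * codeg H u v := by linarith
  exact_mod_cast this
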